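/- arXiv:1107.1670 — 2 statements merged into one kernel-verified Lean document; each statement's English description precedes it below -/
import Mathlib

section
/- Let E be a Banach space and 1 ≤ p < ∞. Then E has the p-approximation property if and only if for every Banach space F and every m ∈ ℕ, the finite-rank polynomials P(^mF) ⊗ E are dense in the space of p-compact m-homogeneous polynomials P_{K_p}(^mF;E) with respect to the supremum norm. -/
open scoped ENNReal NNReal Classical
open Filter Metric

noncomputable section

/-- Membership in the closed unit ball of `ℓ_q`, where `q` is the conjugate exponent of `p`
(`q = ∞`, i.e. bounded coefficients, when `p = 1`). -/
def ConjUnitBall (p : ℝ) (α : ℕ → ℂ) : Prop :=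
  if p = 1 then ∀ n, ‖α n‖ ≤ 1
  else (Summable fun n => ‖α n‖ ^ (p / (p - 1))) ∧ (∑' n, ‖α n‖ ^ (p / (p - 1))) ≤ 1

variable {E F : Type*} [NormedAddCommGroup E] [NormedSpace ℂ E]
  [NormedAddCommGroup F] [NormedSpace ℂ F]

/-- The `p`-convex hull `p-co{x_n}` of a sequence `(x_n)`. -/
def pCo (p : ℝ) (x : ℕ → F) : Set F :=
  {y | ∃ α : ℕ → ℂ, ConjUnitBall p α ∧ HasSum (fun n => α n • x n) y}

/-- A set is relatively `p`-compact if it is contained in the `p`-convex hull of a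
`p`-summable sequence. -/
def IsRelPCompact (p : ℝ) (K : Set F) : Prop :=
  ∃ x : ℕ → F, (Summable fun n => ‖x n‖ ^ p) ∧ K ⊆ pCo p x

/-- The measure of `p`-compactness `m_p(K)`. -/
def mP (p : ℝ) (K : Set F) : ℝ :=
  sInf {r : ℝ | ∃ x : ℕ → F, (Summable fun n => ‖x n‖ ^ p) ∧ K ⊆ pCo p x ∧
    r = (∑' n, ‖x n‖ ^ p) ^ (1 / p)}

/-- `m_p(K)` as an element of `[0, ∞]`; it equals `∞` when `K` is not relatively
`p`-compact. -/
def mPE (p : ℝ) (K : Set F) : ℝ≥0∞ :=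
  sInf {r : ℝ≥0∞ | ∃ x : ℕ → F, (Summable fun n => ‖x n‖ ^ p) ∧ K ⊆ pCo p x ∧
    r = ENNReal.ofReal ((∑' n, ‖x n‖ ^ p) ^ (1 / p))}

/-- The `m`-homogeneous polynomial `P_m f(x₀)` in the Taylor series expansion of `f` at `x₀`. -/
def taylorPoly (f : E → F) (x₀ : E) (m : ℕ) (x : E) : F :=
  ((m.factorial : ℂ))⁻¹ • iteratedFDeriv ℂ m f x₀ fun _ => x

/-- `f` is `p`-compact at `x₀` if some neighborhood of `x₀` has relatively `p`-compact
image under `f`. -/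
def PCompactAt (p : ℝ) (f : E → F) (x₀ : E) : Prop :=
  ∃ V ∈ nhds x₀, IsRelPCompact p (f '' V)

/-- The radius of `p`-compact convergence of `f` at `x₀`:
`r_p(f, x₀) = 1 / limsup κ_p(P_mf(x₀))^{1/m}` (with the conventions `1/0 = ∞`, and
`κ_p(P) = ∞` when `P` is not `p`-compact, so that `r_p(f,x₀) = 0` in that case). -/
def pRadius (p : ℝ) (f : E → F) (x₀ : E) : ℝ≥0∞ :=
  (Filter.limsup (fun m : ℕ => (mPE p (taylorPoly f x₀ m '' closedBall 0 1)) ^ (1 / (m : ℝ)))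
    Filter.atTop)⁻¹

/-- The `m`-homogeneous polynomial associated to a continuous `m`-linear map. -/
def polyEval {E F : Type*} [NormedAddCommGroup E] [NormedSpace ℂ E]
    [NormedAddCommGroup F] [NormedSpace ℂ F] {m : ℕ}
    (A : ContinuousMultilinearMap ℂ (fun _ : Fin m => E) F) (x : E) : F :=
  A fun _ => x

/-- A Banach space `E` has the `p`-approximation property if the identity map can be
approximated, uniformly on every `p`-compact subset of `E`, by bounded finite-rank
linear operators. -/
def HasPApproxProp (p : ℝ) (E : Type*) [NormedAddCommGroup E] [NormedSpace ℂ E] : Prop :=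
  ∀ K : Set E, IsRelPCompact p K → ∀ ε : ℝ, 0 < ε →
    ∃ T : E →L[ℂ] E, FiniteDimensional ℂ (LinearMap.range (T : E →ₗ[ℂ] E)) ∧
      ∀ x ∈ K, ‖T x - x‖ ≤ ε

universe u

/-- The conjugate exponent of `p`, as an extended nonnegative real. -/
def conjExp (p : ℝ) : ℝ≥0∞ := if p = 1 then ∞ else ENNReal.ofReal (p / (p - 1))

lemma one_le_conjExp {p : ℝ} (hp : 1 ≤ p) : 1 ≤ conjExp p := by
  unfold conjExp
  split_ifs with h
  · exact le_top
  · have h1 : 0 < p - 1 := sub_pos.2 (lt_of_le_of_ne hp (Ne.symm h))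
    rw [ENNReal.one_le_ofReal, le_div_iff₀ h1]
    linarith

lemma toReal_conjExp {p : ℝ} (hp : 1 < p) : (conjExp p).toReal = p / (p - 1) := by
  rw [conjExp, if_neg hp.ne', ENNReal.toReal_ofReal]
  exact div_nonneg (by linarith) (by linarith)

lemma ConjUnitBall.memℓp {p : ℝ} (hp : 1 ≤ p) {α : ℕ → ℂ} (h : ConjUnitBall p α) :
    Memℓp α (conjExp p) := by
  rcases hp.eq_or_lt with rfl | hp
  · rw [ConjUnitBall, if_pos rfl] at h
    rw [conjExp, if_pos rfl]
    exact memℓp_infty ⟨1, by rintro _ ⟨n, rfl⟩; exact h n⟩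
  · rw [ConjUnitBall, if_neg hp.ne'] at h
    apply memℓp_gen
    rw [toReal_conjExp hp]
    exact h.1

lemma conjUnitBall_iff_norm_le_one {p : ℝ} (hp : 1 ≤ p) [Fact (1 ≤ conjExp p)]
    (α : lp (fun _ : ℕ => ℂ) (conjExp p)) : ConjUnitBall p α ↔ ‖α‖ ≤ 1 := by
  rcases hp.eq_or_lt with rfl | hp
  · rw [ConjUnitBall, if_pos rfl]
    have hq : conjExp 1 = ∞ := if_pos rfl
    refine ⟨fun h => ?_, fun h n => (lp.norm_apply_le_norm (by simp [hq]) α n).trans h⟩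
    generalize conjExp 1 = q at *
    subst hq
    exact lp.norm_le_of_forall_le zero_le_one h
  · rw [ConjUnitBall, if_neg hp.ne']
    have hq := toReal_conjExp hp
    have hq0 : 0 < (conjExp p).toReal := hq ▸ div_pos (by linarith) (by linarith)
    rw [← hq, ← lp.norm_rpow_eq_tsum hq0, and_iff_right ((lp.memℓp α).summable hq0)]
    simpa using Real.rpow_le_rpow_iff (norm_nonneg α) zero_le_one hq0

lemma exists_summable_norm_smul_bound {p : ℝ} (hp : 1 ≤ p) [Fact (1 ≤ conjExp p)] {y : ℕ → E}
    (hy : Summable fun n => ‖y n‖ ^ p) :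
    ∃ C : ℝ, ∀ α : lp (fun _ : ℕ => ℂ) (conjExp p),
      (Summable fun n => ‖α n • y n‖) ∧ ∑' n, ‖α n • y n‖ ≤ C * ‖α‖ := by
  simp_rw [norm_smul]
  rcases hp.eq_or_lt with rfl | hp
  · simp only [Real.rpow_one] at hy
    refine ⟨∑' n, ‖y n‖, fun α => ?_⟩
    have hb : ∀ n, ‖α n‖ * ‖y n‖ ≤ ‖α‖ * ‖y n‖ := fun n =>
      mul_le_mul_of_nonneg_right
        (lp.norm_apply_le_norm (zero_lt_one.trans_le Fact.out).ne' α n) (norm_nonneg _)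
    have hs : Summable fun n => ‖α n‖ * ‖y n‖ :=
      (hy.mul_left ‖α‖).of_nonneg_of_le (fun n => by positivity) hb
    refine ⟨hs, (hs.tsum_le_tsum hb (hy.mul_left _)).trans_eq ?_⟩
    rw [tsum_mul_left, mul_comm]
  · have hpq : (conjExp p).toReal.HolderConjugate p := by
      rw [toReal_conjExp hp]
      exact (Real.HolderConjugate.conjExponent hp).symm
    refine ⟨(∑' n, ‖y n‖ ^ p) ^ (1 / p), fun α => ?_⟩
    have h := Real.summable_and_inner_le_Lp_mul_Lq_tsum_of_nonneg hpq
      (fun n => norm_nonneg (α n)) (fun n => norm_nonneg (y n))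
      ((lp.memℓp α).summable hpq.pos) hy
    rwa [← lp.norm_eq_tsum_rpow hpq.pos, mul_comm ‖α‖] at h

/-- A `p`-summable sequence `y` has a bounded synthesis operator `α ↦ ∑ α_n y_n` on `ℓ_q`. -/
lemma exists_synthesis [CompleteSpace E] {p : ℝ} (hp : 1 ≤ p) [Fact (1 ≤ conjExp p)]
    {y : ℕ → E} (hy : Summable fun n => ‖y n‖ ^ p) :
    ∃ J : lp (fun _ : ℕ => ℂ) (conjExp p) →L[ℂ] E, ∀ α, HasSum (fun n => α n • y n) (J α) := by
  obtain ⟨C, hC⟩ := exists_summable_norm_smul_bound hp hy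
  have hs : ∀ α : lp (fun _ : ℕ => ℂ) (conjExp p), Summable fun n => α n • y n :=
    fun α => (hC α).1.of_norm
  refine ⟨LinearMap.mkContinuous
    { toFun := fun α => ∑' n, α n • y n
      map_add' := fun α β => ?_
      map_smul' := fun c α => ?_ } C fun α => ?_, fun α => (hs α).hasSum⟩
  · rw [← (hs α).tsum_add (hs β)]
    simp [add_smul]
  · rw [RingHom.id_apply, ← (hs α).tsum_const_smul]
    simp [mul_smul]
  · exact (norm_tsum_le_tsum_norm (hC α).1).trans (hC α).2

/-- The diagonal operator on `ℓ_q` with bounded entries. -/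
lemma exists_diagonal {q : ℝ≥0∞} [Fact (1 ≤ q)] {γ : ℕ → ℝ} {C : ℝ} (hγ : ∀ n, |γ n| ≤ C) :
    ∃ M : lp (fun _ : ℕ => ℂ) q →L[ℂ] lp (fun _ : ℕ => ℂ) q,
      (∀ α n, M α n = γ n * α n) ∧ ‖M‖ ≤ C := by
  have hC : 0 ≤ C := (abs_nonneg _).trans (hγ 0)
  have hb : ∀ (α : lp (fun _ : ℕ => ℂ) q) n, ‖(γ n : ℂ) * α n‖ ≤ ‖((C : ℂ) • α) n‖ := by
    intro α n
    rw [lp.coeFn_smul, Pi.smul_apply, norm_smul, norm_mul, Complex.norm_real, Complex.norm_real,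
      Real.norm_eq_abs, Real.norm_eq_abs, abs_of_nonneg hC]
    exact mul_le_mul_of_nonneg_right (hγ n) (norm_nonneg _)
  refine ⟨LinearMap.mkContinuous
    { toFun := fun α => ⟨fun n => γ n * α n, (lp.memℓp ((C : ℂ) • α)).mono' (hb α)⟩
      map_add' := fun α β => ?_
      map_smul' := fun c α => ?_ } C fun α => ?_, fun α n => rfl,
      LinearMap.mkContinuous_norm_le _ hC _⟩
  · ext n
    exact mul_add _ _ _
  · ext n
    exact mul_left_comm _ _ _
  · refine (lp.norm_mono (y := (C : ℂ) • α) (zero_lt_one.trans_le Fact.out).ne' (hb α)).trans_eq ?_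
    rw [norm_smul, Complex.norm_real, Real.norm_eq_abs, abs_of_nonneg hC]

lemma isCompactOperator_diagonal {q : ℝ≥0∞} [Fact (1 ≤ q)] {γ : ℕ → ℝ}
    (hγ : Tendsto γ atTop (nhds 0)) {M : lp (fun _ : ℕ => ℂ) q →L[ℂ] lp (fun _ : ℕ => ℂ) q}
    (hM : ∀ α n, M α n = γ n * α n) : IsCompactOperator M := by
  have hq : q ≠ 0 := (zero_lt_one.trans_le Fact.out).ne'
  let ev : ℕ → lp (fun _ : ℕ => ℂ) q →L[ℂ] ℂ := fun n => LinearMap.mkContinuous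
    { toFun := fun α => α n
      map_add' := fun α β => rfl
      map_smul' := fun c α => rfl } 1 fun α => by
        rw [one_mul]; exact lp.norm_apply_le_norm hq α n
  let P : ℕ → lp (fun _ : ℕ => ℂ) q →L[ℂ] lp (fun _ : ℕ => ℂ) q := fun N =>
    ∑ n ∈ Finset.range N,
      (lp.singleContinuousLinearMap ℂ (fun _ : ℕ => ℂ) q n).comp ((γ n : ℂ) • ev n)
  have hP : ∀ N α k, P N α k = if k < N then γ k * α k else 0 := by
    intro N α k
    simp only [P, _root_.sum_apply, lp.coeFn_sum, Finset.sum_apply,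
      ContinuousLinearMap.comp_apply, lp.singleContinuousLinearMap_apply, lp.single_apply]
    simp only [ev, Pi.single_apply, Finset.sum_ite_eq, Finset.mem_range]
    rfl
  refine isCompactOperator_of_tendsto (l := atTop) (F := P) ?_ (Eventually.of_forall fun N => ?_)
  · rw [Metric.tendsto_atTop]
    intro ε hε
    obtain ⟨N, hN⟩ := Metric.tendsto_atTop.1 hγ (ε / 2) (half_pos hε)
    refine ⟨N, fun K hK => ?_⟩
    obtain ⟨R, hR, hRn⟩ := exists_diagonal (q := q)
      (γ := fun n => if n < K then 0 else - γ n) (C := ε / 2) fun n => by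
        split_ifs with h
        · simpa using (half_pos hε).le
        · have := hN n (by omega)
          rw [Real.dist_eq, sub_zero] at this
          rw [abs_neg]
          exact this.le
    have : P K - M = R := by
      ext α k
      rw [_root_.sub_apply, lp.coeFn_sub, Pi.sub_apply, hP, hM, hR]
      split_ifs <;> simp
    rw [dist_eq_norm, this]
    linarith
  · suffices h : P N ∈ compactOperator (RingHom.id ℂ) (lp (fun _ : ℕ => ℂ) q)
      (lp (fun _ : ℕ => ℂ) q) from h
    refine Submodule.sum_mem _ fun n _ => ?_
    change IsCompactOperator (lp.singleContinuousLinearMap ℂ (fun _ : ℕ => ℂ) q n ∘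
      ((γ n : ℂ) • ev n))
    exact (isCompactOperator_of_locallyCompactSpace_dom ((γ n : ℂ) • ev n)).clm_comp _

/-- On a compact absolutely convex set, a continuous functional is uniformly approximated by
functionals factoring through a given injective operator. -/
lemma exists_dual_comp_approx {J : F →L[ℂ] E} (hJ : Function.Injective J) {D : Set F}
    (hD : IsCompact D) (hconv : Convex ℝ D) (hbal : Balanced ℂ D) (φ : F →L[ℂ] ℂ) {ε : ℝ}
    (hε : 0 < ε) : ∃ ψ : E →L[ℂ] ℂ, ∀ d ∈ D, ‖φ d - ψ (J d)‖ ≤ ε := by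
  rcases D.eq_empty_or_nonempty with rfl | hne
  · exact ⟨0, by simp⟩
  let L : F →L[ℂ] E × ℂ := J.prod φ
  have hnot : ((0 : E), (ε : ℂ)) ∉ L '' D := by
    rintro ⟨d, -, hd⟩
    have h1 : J d = 0 := congrArg Prod.fst hd
    have h2 : φ d = ε := congrArg Prod.snd hd
    rw [(map_eq_zero_iff J hJ).1 h1, map_zero] at h2
    exact hε.ne (by exact_mod_cast h2)
  obtain ⟨f, s, hf, hs⟩ := RCLike.geometric_hahn_banach_closed_point (𝕜 := ℂ)
    (hconv.linear_image (L.restrictScalars ℝ : F →ₗ[ℝ] E × ℂ))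
    (hD.image L.continuous).isClosed hnot
  let c : ℂ := f (0, 1)
  let g : E →L[ℂ] ℂ := f.comp (ContinuousLinearMap.inl ℂ E ℂ)
  have hfe : ∀ x z, f (x, z) = g x + z * c := by
    intro x z
    have : (x, z) = ContinuousLinearMap.inl ℂ E ℂ x + z • ((0 : E), (1 : ℂ)) := by simp
    rw [this, map_add, map_smul]
    rfl
  have hnorm : ∀ d ∈ D, ‖g (J d) + φ d * c‖ ≤ s := by
    intro d hd
    set w := g (J d) + φ d * c with hw
    obtain ⟨u, hu, huw⟩ : ∃ u : ℂ, ‖u‖ ≤ 1 ∧ u * w = ‖w‖ := by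
      rcases eq_or_ne w 0 with h | h
      · exact ⟨0, by simp, by simp [h]⟩
      · have h' : (‖w‖ : ℂ) ≠ 0 := by simpa using h
        refine ⟨starRingEnd ℂ w / ‖w‖, ?_, ?_⟩
        · simp [h]
        · rw [div_mul_eq_mul_div, Complex.conj_mul', sq, mul_div_assoc, div_self h', mul_one]
    have := hf _ ⟨u • d, hbal.smul_mem hu hd, rfl⟩
    have he : f (L (u • d)) = ‖w‖ := by
      rw [map_smul, map_smul, smul_eq_mul, ← huw, hw, ← hfe]
      rfl
    change RCLike.re (f (L (u • d))) < s at this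
    rw [he] at this
    simpa using this.le
  have hs0 : 0 ≤ s := by
    obtain ⟨d, hd⟩ := hne
    exact (norm_nonneg _).trans (hnorm d hd)
  have hsc : s ≤ ε * ‖c‖ := by
    refine hs.le.trans ((RCLike.re_le_norm _).trans ?_)
    rw [hfe, map_zero, zero_add, norm_mul, Complex.norm_real, Real.norm_eq_abs, abs_of_pos hε]
  have hc : c ≠ 0 := by
    rintro h
    rw [hfe] at hs
    simp [h] at hs
    linarith
  have hc' : 0 < ‖c‖ := norm_pos_iff.2 hc
  refine ⟨-(c⁻¹ • g), fun d hd => ?_⟩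
  have : φ d - (-(c⁻¹ • g)) (J d) = c⁻¹ * (g (J d) + φ d * c) := by
    simp only [_root_.neg_apply, _root_.smul_apply, smul_eq_mul]
    field_simp
    ring
  rw [this, norm_mul, norm_inv, inv_mul_le_iff₀ hc', mul_comm ‖c‖]
  exact (hnorm d hd).trans hsc

/-- A summable nonnegative sequence stays summable after division by some null sequence. -/
lemma exists_tendsto_zero_summable_div {a : ℕ → ℝ} (ha : ∀ n, 0 ≤ a n) (hs : Summable a) :
    ∃ γ : ℕ → ℝ, (∀ n, 0 < γ n) ∧ Tendsto γ atTop (nhds 0) ∧ Summable fun n => a n / γ n := by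
  let b : ℕ → ℝ := fun n => a n + (1 / 2) ^ n
  have hb : Summable b := hs.add summable_geometric_two
  have hbpos : ∀ n, 0 < b n := fun n => add_pos_of_nonneg_of_pos (ha n) (by positivity)
  let r : ℕ → ℝ := fun n => ∑' k, b (k + n)
  have hr : ∀ n, r n = b n + r (n + 1) := by
    intro n
    have := ((summable_nat_add_iff n).2 hb).tsum_eq_zero_add
    simp only [zero_add] at this
    simp only [r, this]
    congr 2
    ext k
    congr 1
    omega
  have hrpos : ∀ n, 0 < r n := fun n =>
    ((summable_nat_add_iff n).2 hb).tsum_pos (fun k => (hbpos _).le) 0 (hbpos _)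
  have hr0 : Tendsto r atTop (nhds 0) := tendsto_sum_nat_add b
  refine ⟨fun n => √(r n), fun n => Real.sqrt_pos.2 (hrpos n), ?_, ?_⟩
  · simpa [Function.comp_def] using (Real.continuous_sqrt.tendsto 0).comp hr0
  · have key : ∀ n, a n / √(r n) ≤ 2 * (√(r n) - √(r (n + 1))) := by
      intro n
      have h1 := Real.sqrt_pos.2 (hrpos n)
      have h2 := Real.sqrt_nonneg (r (n + 1))
      have h3 := Real.sq_sqrt (hrpos n).le
      have h4 := Real.sq_sqrt (hrpos (n + 1)).le
      have h5 := hr n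
      have h6 : a n ≤ b n := le_add_of_nonneg_right (by positivity)
      rw [div_le_iff₀ h1]
      nlinarith [sq_nonneg (√(r n) - √(r (n + 1)))]
    refine summable_of_sum_range_le (c := 2 * √(r 0))
      (fun n => div_nonneg (ha n) (Real.sqrt_nonneg _)) fun N => ?_
    refine (Finset.sum_le_sum fun n _ => key n).trans ?_
    rw [← Finset.mul_sum, Finset.sum_range_sub']
    linarith [Real.sqrt_nonneg (r N)]

/-- A finite-rank operator on `E` is a finite sum of rank-one operators. -/
lemma exists_eq_sum_of_finiteDimensional_range (T : E →L[ℂ] E)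
    (hT : FiniteDimensional ℂ (LinearMap.range (T : E →ₗ[ℂ] E))) :
    ∃ (n : ℕ) (φ : Fin n → E →L[ℂ] ℂ) (v : Fin n → E), ∀ x, T x = ∑ i, φ i x • v i := by
  let V := LinearMap.range (T : E →ₗ[ℂ] E)
  let b := Module.finBasis ℂ V
  let T' : E →L[ℂ] V := T.codRestrict V fun x => ⟨x, rfl⟩
  refine ⟨_, fun i => (LinearMap.toContinuousLinearMap (b.coord i)).comp T', fun i => b i,
    fun x => ?_⟩
  refine (congrArg Subtype.val (b.sum_repr (T' x))).symm.trans ?_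
  rw [Submodule.coe_sum]
  rfl

lemma finiteDimensional_range_sum_smulRight {n : ℕ} (ψ : Fin n → E →L[ℂ] ℂ) (v : Fin n → E) :
    FiniteDimensional ℂ
      (LinearMap.range ((∑ i, (ψ i).smulRight (v i) : E →L[ℂ] E) : E →ₗ[ℂ] E)) := by
  have : FiniteDimensional ℂ (Submodule.span ℂ (Set.range v)) :=
    FiniteDimensional.span_of_finite ℂ (Set.finite_range v)
  refine Submodule.finiteDimensional_of_le (S₂ := Submodule.span ℂ (Set.range v)) ?_
  rintro _ ⟨x, rfl⟩
  simp only [ContinuousLinearMap.coe_coe, _root_.sum_apply, ContinuousLinearMap.smulRight_apply]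
  exact Submodule.sum_mem _ fun i _ =>
    Submodule.smul_mem _ _ (Submodule.subset_span (Set.mem_range_self i))

/-- Every relatively `p`-compact set `K` is covered by `J (W B)`, where `B` is the unit ball of `ℓ_q`,
`W` is a compact operator and `J` is an injective operator mapping balls to relatively `p`-compact
sets. -/
lemma IsRelPCompact.exists_factorization {E : Type u} [NormedAddCommGroup E] [NormedSpace ℂ E]
    [CompleteSpace E] {p : ℝ} (hp : 1 ≤ p) [Fact (1 ≤ conjExp p)] {K : Set E}
    (hK : IsRelPCompact p K) :
    ∃ (F : Type u) (_ : NormedAddCommGroup F) (_ : NormedSpace ℂ F) (_ : CompleteSpace F)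
      (J : F →L[ℂ] E) (W : lp (fun _ : ℕ => ℂ) (conjExp p) →L[ℂ] F),
      Function.Injective J ∧ IsRelPCompact p (J '' closedBall 0 1) ∧ IsCompactOperator W ∧
        K ⊆ (fun α => J (W α)) '' closedBall 0 1 := by
  obtain ⟨x, hx, hxK⟩ := hK
  have hp0 : 0 < p := zero_lt_one.trans_le hp
  obtain ⟨γ, hγ, hγ0, hγs⟩ := exists_tendsto_zero_summable_div
    (fun n => Real.rpow_nonneg (norm_nonneg (x n)) p) hx
  let δ : ℕ → ℝ := fun n => γ n ^ (1 / p)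
  have hδ : ∀ n, 0 < δ n := fun n => Real.rpow_pos_of_pos (hγ n) _
  have hδ0 : Tendsto δ atTop (nhds 0) := by
    have := hγ0.rpow_const (p := 1 / p) (Or.inr (by positivity))
    rwa [Real.zero_rpow (by positivity)] at this
  obtain ⟨C, hC⟩ := hδ0.abs.bddAbove_range
  obtain ⟨M, hM, -⟩ := exists_diagonal (q := conjExp p) (γ := δ) (C := C)
    fun n => hC ⟨n, rfl⟩
  have hMc := isCompactOperator_diagonal hδ0 hM
  let y : ℕ → E := fun n => ((δ n)⁻¹ : ℂ) • x n
  have hynorm : ∀ n, ‖y n‖ ^ p = ‖x n‖ ^ p / γ n := by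
    intro n
    have h1 : ‖y n‖ = ‖x n‖ / δ n := by
      rw [norm_smul, norm_inv, Complex.norm_real, Real.norm_eq_abs, abs_of_pos (hδ n),
        inv_mul_eq_div]
    rw [h1, Real.div_rpow (norm_nonneg _) (hδ n).le, ← Real.rpow_mul (hγ n).le,
      one_div_mul_cancel hp0.ne', Real.rpow_one]
  have hy : Summable fun n => ‖y n‖ ^ p := by simpa only [hynorm] using hγs
  obtain ⟨J₀, hJ₀⟩ := exists_synthesis hp hy
  let N := J₀.ker
  have : IsClosed (N : Set (lp (fun _ : ℕ => ℂ) (conjExp p))) := J₀.isClosed_ker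
  let e : ULift.{u} (lp (fun _ : ℕ => ℂ) (conjExp p) ⧸ N) ≃L[ℂ] _ := ContinuousLinearEquiv.ulift
  let J₁ : (lp (fun _ : ℕ => ℂ) (conjExp p) ⧸ N) →L[ℂ] E := N.liftQL J₀ le_rfl
  have hJ₁ : ∀ α, J₁ (N.mkQ α) = J₀ α := fun α => rfl
  refine ⟨ULift.{u} (lp (fun _ : ℕ => ℂ) (conjExp p) ⧸ N), inferInstance, inferInstance,
    inferInstance, J₁.comp (e : _ →L[ℂ] _), ((e.symm : _ →L[ℂ] _).comp N.mkQL).comp M,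
    ?_, ?_, ?_, ?_⟩
  · have h : Function.Injective J₁ := by
      rw [injective_iff_map_eq_zero]
      intro z hz
      obtain ⟨α, rfl⟩ := N.mkQ_surjective z
      rw [hJ₁] at hz
      exact (Submodule.Quotient.mk_eq_zero N).2 hz
    exact h.comp e.injective
  · refine ⟨fun n => (2 : ℂ) • y n, ?_, ?_⟩
    · simp_rw [norm_smul, Real.mul_rpow (norm_nonneg _) (norm_nonneg _)]
      exact hy.mul_left _
    · rintro _ ⟨z, hz, rfl⟩
      obtain ⟨α, hα, hαn⟩ := Submodule.Quotient.norm_mk_lt z.down one_pos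
      have hz1 : ‖z.down‖ ≤ 1 := mem_closedBall_zero_iff.1 hz
      refine ⟨((2 : ℂ)⁻¹ • α : lp (fun _ : ℕ => ℂ) (conjExp p)), ?_, ?_⟩
      · rw [conjUnitBall_iff_norm_le_one hp, norm_smul]
        norm_num
        linarith
      · have h1 : (J₁.comp (e : _ →L[ℂ] _)) z = J₀ α := by
          rw [← hJ₁]
          change J₁ z.down = J₁ (Submodule.Quotient.mk α)
          rw [hα]
        rw [h1]
        convert hJ₀ α using 2 with n
        rw [lp.coeFn_smul, Pi.smul_apply, smul_eq_mul, smul_smul]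
        congr 1
        ring
  · exact hMc.continuous_comp (e.symm.continuous.comp N.mkQL.continuous)
  · intro z hz
    obtain ⟨α, hα, hαz⟩ := hxK hz
    let β : lp (fun _ : ℕ => ℂ) (conjExp p) := ⟨α, hα.memℓp hp⟩
    refine ⟨β, mem_closedBall_zero_iff.2 ((conjUnitBall_iff_norm_le_one hp β).1 hα), ?_⟩
    change J₀ (M β) = z
    refine (hJ₀ (M β)).unique ?_
    convert hαz using 2 with n
    have : (δ n : ℂ) ≠ 0 := by exact_mod_cast (hδ n).ne'
    rw [hM, smul_smul]
    congr 1
    change (δ n : ℂ) * α n * (δ n : ℂ)⁻¹ = α n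
    field_simp

lemma exists_finiteRank_approx_of_factorization {G : Type*} [NormedAddCommGroup G]
    [NormedSpace ℂ G] {J : F →L[ℂ] E} {W : G →L[ℂ] F} (hJ : Function.Injective J)
    (hW : IsCompactOperator W)
    (h : ∀ ε : ℝ, 0 < ε → ∃ (n : ℕ) (φ : Fin n → F →L[ℂ] ℂ) (v : Fin n → E),
      ∀ x ∈ closedBall (0 : F) 1, ‖J x - ∑ i, φ i x • v i‖ ≤ ε) {ε : ℝ} (hε : 0 < ε) :
    ∃ T : E →L[ℂ] E, FiniteDimensional ℂ (LinearMap.range (T : E →ₗ[ℂ] E)) ∧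
      ∀ α ∈ closedBall (0 : G) 1, ‖T (J (W α)) - J (W α)‖ ≤ ε := by
  let D := closure (W '' closedBall 0 1)
  have hD : IsCompact D := hW.isCompact_closure_image_closedBall (f := (W : G →ₗ[ℂ] F)) 1
  have hDconv : Convex ℝ D :=
    ((convex_closedBall _ _).linear_image (W.restrictScalars ℝ : G →ₗ[ℝ] F)).closure
  have hDbal : Balanced ℂ D := by
    refine Balanced.closure ?_
    rintro a ha _ ⟨_, ⟨α, hα, rfl⟩, rfl⟩
    exact ⟨a • α, balanced_closedBall_zero.smul_mem ha hα, map_smul W a α⟩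
  let R := ‖W‖ + 1
  have hR : 0 < R := by positivity
  obtain ⟨n, φ, v, hφ⟩ := h (ε / 2 / R) (by positivity)
  let S := ∑ i, ‖v i‖ + 1
  have hS : 0 < S := add_pos_of_nonneg_of_pos (Finset.sum_nonneg fun i _ => norm_nonneg _) one_pos
  choose ψ hψ using fun i =>
    exists_dual_comp_approx hJ hD hDconv hDbal (φ i) (ε := ε / 2 / S) (by positivity)
  refine ⟨∑ i, (ψ i).smulRight (v i), finiteDimensional_range_sum_smulRight ψ v, fun α hα => ?_⟩
  have hd : W α ∈ D := subset_closure ⟨α, hα, rfl⟩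
  have hdR : ‖W α‖ ≤ R := by
    have := W.le_of_opNorm_le_of_le le_rfl (mem_closedBall_zero_iff.1 hα)
    linarith
  generalize W α = d at hd hdR
  have h1 : ‖J d - ∑ i, φ i d • v i‖ ≤ ε / 2 := by
    have hRd : ((R⁻¹ : ℝ) : ℂ) • d ∈ closedBall (0 : F) 1 := by
      rw [mem_closedBall_zero_iff, norm_smul, Complex.norm_real, Real.norm_eq_abs,
        abs_of_pos (inv_pos.2 hR), inv_mul_le_iff₀ hR, mul_one]
      exact hdR
    have := hφ _ hRd
    simp only [map_smul, smul_assoc] at this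
    rwa [← Finset.smul_sum, ← smul_sub, norm_smul, Complex.norm_real, Real.norm_eq_abs,
      abs_of_pos (inv_pos.2 hR), inv_mul_eq_div, div_le_div_iff_of_pos_right hR] at this
  have h2 : ‖∑ i, (φ i d - ψ i (J d)) • v i‖ ≤ ε / 2 := by
    calc ‖∑ i, (φ i d - ψ i (J d)) • v i‖ ≤ ∑ i, ε / 2 / S * ‖v i‖ := by
          refine norm_sum_le_of_le _ fun i _ => ?_
          rw [norm_smul]
          exact mul_le_mul_of_nonneg_right (hψ i d hd) (norm_nonneg _)
      _ = ε / 2 / S * ∑ i, ‖v i‖ := by rw [Finset.mul_sum]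
      _ ≤ ε / 2 / S * S := by
          refine mul_le_mul_of_nonneg_left ?_ (by positivity)
          simp [S]
      _ = ε / 2 := div_mul_cancel₀ _ hS.ne'
  have h3 : (∑ i, (ψ i).smulRight (v i) : E →L[ℂ] E) (J d) - J d =
      -(J d - ∑ i, φ i d • v i) - ∑ i, (φ i d - ψ i (J d)) • v i := by
    simp only [_root_.sum_apply, ContinuousLinearMap.smulRight_apply, sub_smul,
      Finset.sum_sub_distrib]
    abel
  calc _ ≤ ‖-(J d - ∑ i, φ i d • v i)‖ + ‖∑ i, (φ i d - ψ i (J d)) • v i‖ := by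
        rw [h3]; exact norm_sub_le _ _
    _ ≤ ε / 2 + ε / 2 := by rw [norm_neg]; exact add_le_add h1 h2
    _ = ε := add_halves ε

lemma hasPApproxProp_of_forall_operator {E : Type u} [NormedAddCommGroup E] [NormedSpace ℂ E]
    [CompleteSpace E] {p : ℝ} (hp : 1 ≤ p)
    (h : ∀ (F : Type u) (_ : NormedAddCommGroup F) (_ : NormedSpace ℂ F) (_ : CompleteSpace F)
      (J : F →L[ℂ] E), IsRelPCompact p (J '' closedBall 0 1) → ∀ ε : ℝ, 0 < ε →
        ∃ (n : ℕ) (φ : Fin n → F →L[ℂ] ℂ) (v : Fin n → E),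
          ∀ x ∈ closedBall (0 : F) 1, ‖J x - ∑ i, φ i x • v i‖ ≤ ε) :
    HasPApproxProp p E := by
  intro K hK ε hε
  have : Fact (1 ≤ conjExp p) := ⟨one_le_conjExp hp⟩
  obtain ⟨F, _, _, _, J, W, hJ, hJp, hW, hKW⟩ := hK.exists_factorization hp
  obtain ⟨T, hT, hTW⟩ := exists_finiteRank_approx_of_factorization hJ hW (h F _ _ ‹_› J hJp) hε
  refine ⟨T, hT, fun z hz => ?_⟩
  obtain ⟨α, hα, rfl⟩ := hKW hz
  exact hTW α hα

/-- **Proposition 4.2 (second statement).** A Banach space `E` has the `p`-approximation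
property if and only if, for every Banach space `F` and every `m ∈ ℕ`, the finite-rank
polynomials `P(^mF) ⊗ E` are `‖·‖`-dense in the space `P_{K_p}(^mF;E)` of `p`-compact
`m`-homogeneous polynomials from `F` to `E`. -/
theorem statement13 (E : Type u) [NormedAddCommGroup E] [NormedSpace ℂ E] [CompleteSpace E]
    (p : ℝ) (hp : 1 ≤ p) :
    HasPApproxProp p E ↔
      ∀ (F : Type u) (_ : NormedAddCommGroup F) (_ : NormedSpace ℂ F) (_ : CompleteSpace F)
        (m : ℕ) (A : ContinuousMultilinearMap ℂ (fun _ : Fin m => F) E),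
        IsRelPCompact p (polyEval A '' closedBall 0 1) →
        ∀ ε : ℝ, 0 < ε →
          ∃ (n : ℕ) (q : Fin n → ContinuousMultilinearMap ℂ (fun _ : Fin m => F) ℂ)
            (v : Fin n → E),
            ∀ x ∈ closedBall (0 : F) 1,
              ‖polyEval A x - ∑ i, polyEval (q i) x • v i‖ ≤ ε := by
  constructor
  · intro h F _ _ _ m A hA ε hε
    obtain ⟨T, hT, hTA⟩ := h _ hA ε hε
    obtain ⟨n, φ, v, hφ⟩ := exists_eq_sum_of_finiteDimensional_range T hT
    refine ⟨n, fun i => (φ i).compContinuousMultilinearMap A, v, fun x hx => ?_⟩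
    rw [norm_sub_rev]
    have := hTA _ ⟨x, hx, rfl⟩
    rwa [hφ] at this
  · intro h
    refine hasPApproxProp_of_forall_operator hp fun F _ _ _ J hJ ε hε => ?_
    obtain ⟨n, q, v, hq⟩ :=
      h F _ _ ‹_› 1 (ContinuousMultilinearMap.ofSubsingleton ℂ F E (0 : Fin 1) J) hJ ε hε
    refine ⟨n, fun i => (ContinuousMultilinearMap.ofSubsingleton ℂ F ℂ (0 : Fin 1)).symm (q i), v,
      hq⟩

end
end

section
/- Let E and F be complex Banach spaces and 1 ≤ p < ∞. The space H_{K_p}(E;F) of p-compact entire functions is dense, with respect to the Nachbin topology τ_ω, in the space {f : E → F entire : P_mf(x) is p-compact for every x ∈ E and every m ∈ ℕ}. -/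
open scoped ENNReal NNReal Classical
open Filter Metric

noncomputable section

variable {E F : Type*} [NormedAddCommGroup E] [NormedSpace ℂ E]
  [NormedAddCommGroup F] [NormedSpace ℂ F]

open scoped Pointwise

/-- The `m`-th term `sup{‖P_m h(0)(x)‖ : x ∈ K + a_m B_E}` of the Nachbin seminorm
associated to an absolutely convex compact set `K` and a null sequence `(a_m)`. -/
def nachbinTerm (K : Set E) (a : ℕ → ℝ) (h : E → F) (m : ℕ) : ℝ :=
  sSup {r : ℝ | ∃ x ∈ K + closedBall (0 : E) (a m), r = ‖taylorPoly h 0 m x‖}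

theorem taylorPoly_eq_of_hasFPowerSeriesAt [CompleteSpace F] {f : E → F} {x₀ : E}
    {P : FormalMultilinearSeries ℂ E F} (h : HasFPowerSeriesAt f P x₀) (m : ℕ) (x : E) :
    taylorPoly f x₀ m x = P m fun _ => x := by
  obtain ⟨r, hr⟩ := h
  rw [taylorPoly, ← hr.factorial_smul x m, ← Nat.cast_smul_eq_nsmul ℂ, smul_smul,
    inv_mul_cancel₀ (by exact_mod_cast m.factorial_ne_zero), one_smul]

theorem taylorPoly_smul (f : E → F) (x₀ : E) (m : ℕ) (c : ℂ) (x : E) :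
    taylorPoly f x₀ m (c • x) = c ^ m • taylorPoly f x₀ m x := by
  have h := (iteratedFDeriv ℂ m f x₀).map_smul_univ (fun _ => c) (fun _ => x)
  simp only [Finset.prod_const, Finset.card_univ, Fintype.card_fin] at h
  rw [taylorPoly, taylorPoly, h, smul_comm]

/-- Cauchy estimate for the Taylor polynomials at the origin of an entire function. -/
theorem norm_taylorPoly_le [CompleteSpace F] {f : E → F} (hf : ∀ x, AnalyticAt ℂ f x)
    (m : ℕ) (x : E) {R C : ℝ} (hR : 0 < R) (hC : ∀ z : ℂ, ‖z‖ = R → ‖f (z • x)‖ ≤ C) :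
    ‖taylorPoly f 0 m x‖ ≤ C / R ^ m := by
  obtain ⟨P, hP⟩ := hf 0
  set u : ℂ →L[ℂ] E := ContinuousLinearMap.toSpanSingleton ℂ x with hu
  have hP' : HasFPowerSeriesAt f P (u 0) := by simpa using hP
  have hφ := taylorPoly_eq_of_hasFPowerSeriesAt hP'.compContinuousLinearMap m 1
  have heq : taylorPoly f 0 m x = taylorPoly (f ∘ u) 0 m 1 := by
    rw [taylorPoly_eq_of_hasFPowerSeriesAt hP, hφ,
      FormalMultilinearSeries.compContinuousLinearMap_apply]
    congr 1
    ext i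
    simp [hu]
  have hd : Differentiable ℂ (f ∘ u) := fun z =>
    (hf (u z)).differentiableAt.comp z u.differentiableAt
  have hb := Complex.norm_iteratedDeriv_le_of_forall_mem_sphere_norm_le (c := 0) (C := C) m hR
    hd.diffContOnCl (fun z hz => by simpa [hu] using hC z (by simpa using hz))
  have hfac : (0 : ℝ) < m.factorial := by exact_mod_cast m.factorial_pos
  rw [heq, taylorPoly, norm_smul, norm_inv, Complex.norm_natCast,
    ← iteratedDeriv_eq_iteratedFDeriv]
  calc (m.factorial : ℝ)⁻¹ * ‖iteratedDeriv m (f ∘ u) 0‖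
      ≤ (m.factorial : ℝ)⁻¹ * (m.factorial * C / R ^ m) := by gcongr
    _ = C / R ^ m := by field_simp

theorem ConjUnitBall.zero {p : ℝ} (hp : 1 ≤ p) : ConjUnitBall p 0 := by
  unfold ConjUnitBall
  split_ifs with h
  · simp
  · have : 1 < p := lt_of_le_of_ne hp (Ne.symm h)
    have hq : p / (p - 1) ≠ 0 := (div_pos (by linarith) (by linarith)).ne'
    simp [Real.zero_rpow hq]

theorem isRelPCompact_zero {p : ℝ} (hp : 1 ≤ p) : IsRelPCompact p ({0} : Set F) := by
  refine ⟨0, ?_, ?_⟩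
  · simp [Real.zero_rpow (by linarith : p ≠ 0)]
  · rintro _ rfl
    exact ⟨0, ConjUnitBall.zero hp, by simp⟩

theorem IsRelPCompact.mono {p : ℝ} {S T : Set F} (hT : IsRelPCompact p T) (h : S ⊆ T) :
    IsRelPCompact p S := by
  obtain ⟨x, hx, hTx⟩ := hT
  exact ⟨x, hx, h.trans hTx⟩

theorem summable_norm_smul_rpow {p : ℝ} {x : ℕ → F} (hx : Summable fun n => ‖x n‖ ^ p)
    (c : ℂ) : Summable fun n => ‖c • x n‖ ^ p := by
  simp_rw [norm_smul, Real.mul_rpow (norm_nonneg _) (norm_nonneg _)]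
  exact hx.mul_left _

theorem IsRelPCompact.smul {p : ℝ} {S : Set F} (hS : IsRelPCompact p S) (c : ℂ) :
    IsRelPCompact p (c • S) := by
  obtain ⟨x, hx, hSx⟩ := hS
  refine ⟨fun n => c • x n, summable_norm_smul_rpow hx c, ?_⟩
  rintro _ ⟨y, hy, rfl⟩
  obtain ⟨α, hα, hs⟩ := hSx hy
  refine ⟨α, hα, ?_⟩
  simpa only [smul_comm c] using hs.const_smul c

/-- Interleaving two elements of the unit ball of `ℓ_q` with a factor `1 / 2`. -/
theorem ConjUnitBall.interleave {p : ℝ} (hp : 1 ≤ p) {α β : ℕ → ℂ} (hα : ConjUnitBall p α)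
    (hβ : ConjUnitBall p β) :
    ConjUnitBall p fun n => (2⁻¹ : ℂ) • Sum.elim α β (Equiv.natSumNatEquivNat.symm n) := by
  unfold ConjUnitBall at *
  split_ifs at * with h
  · intro n
    have hle : ∀ u : ℕ ⊕ ℕ, ‖Sum.elim α β u‖ ≤ 1 := by
      rintro (k | k)
      exacts [hα k, hβ k]
    rw [norm_smul, norm_inv, Complex.norm_ofNat]
    linarith [hle (Equiv.natSumNatEquivNat.symm n)]
  · have hp1 : 1 < p := lt_of_le_of_ne hp (Ne.symm h)
    set q := p / (p - 1) with hq
    have hq1 : 1 ≤ q := by rw [hq, le_div_iff₀ (by linarith)]; linarith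
    have hc : (2⁻¹ : ℝ) ^ q ≤ 2⁻¹ := by
      simpa using Real.rpow_le_rpow_of_exponent_ge (by norm_num : (0 : ℝ) < 2⁻¹)
        (by norm_num) hq1
    have hsum : HasSum (fun s : ℕ ⊕ ℕ => ‖(2⁻¹ : ℂ) • Sum.elim α β s‖ ^ q)
        ((2⁻¹ : ℝ) ^ q * (∑' n, ‖α n‖ ^ q) + (2⁻¹ : ℝ) ^ q * ∑' n, ‖β n‖ ^ q) := by
      simp_rw [norm_smul, Real.mul_rpow (norm_nonneg _) (norm_nonneg _), norm_inv,
        Complex.norm_ofNat]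
      exact HasSum.sum (hα.1.hasSum.mul_left _) (hβ.1.hasSum.mul_left _)
    have hsum' := (Equiv.natSumNatEquivNat.symm.hasSum_iff).2 hsum
    refine ⟨hsum'.summable, hsum'.tsum_eq.trans_le ?_⟩
    have hA : 0 ≤ ∑' n, ‖α n‖ ^ q := tsum_nonneg fun n => by positivity
    have hB : 0 ≤ ∑' n, ‖β n‖ ^ q := tsum_nonneg fun n => by positivity
    nlinarith [hα.2, hβ.2]

theorem IsRelPCompact.add {p : ℝ} (hp : 1 ≤ p) {S T : Set F} (hS : IsRelPCompact p S)
    (hT : IsRelPCompact p T) : IsRelPCompact p (S + T) := by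
  obtain ⟨x, hx, hSx⟩ := hS
  obtain ⟨y, hy, hTy⟩ := hT
  refine ⟨fun n => (2 : ℂ) • Sum.elim x y (Equiv.natSumNatEquivNat.symm n), ?_, ?_⟩
  · refine (Equiv.natSumNatEquivNat.symm.summable_iff
      (f := fun s => ‖(2 : ℂ) • Sum.elim x y s‖ ^ p)).2 ?_
    exact Summable.sum _ (summable_norm_smul_rpow hx 2) (summable_norm_smul_rpow hy 2)
  · rintro _ ⟨s, hs, t, ht, rfl⟩
    obtain ⟨α, hα, hsα⟩ := hSx hs
    obtain ⟨β, hβ, htβ⟩ := hTy ht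
    refine ⟨_, hα.interleave hp hβ, ?_⟩
    have key : HasSum (fun u : ℕ ⊕ ℕ => Sum.elim α β u • Sum.elim x y u) (s + t) :=
      HasSum.sum hsα htβ
    convert (Equiv.natSumNatEquivNat.symm.hasSum_iff).2 key using 2 with n
    simp [smul_smul, mul_right_comm]

/-- A finite sum of `p`-compact Taylor polynomials maps balls to relatively `p`-compact sets. -/
theorem isRelPCompact_image_sum_taylorPoly {p : ℝ} (hp : 1 ≤ p) {f : E → F} {x₀ : E}
    (hPm : ∀ m, IsRelPCompact p (taylorPoly f x₀ m '' closedBall 0 1)) {R : ℝ} (hR : 0 < R)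
    (M : ℕ) :
    IsRelPCompact p ((fun x => ∑ m ∈ Finset.range M, taylorPoly f x₀ m x) '' closedBall 0 R) := by
  induction M with
  | zero =>
    refine (isRelPCompact_zero hp).mono ?_
    rintro _ ⟨x, -, rfl⟩
    simp
  | succ M ih =>
    refine (ih.add hp ((hPm M).smul ((R : ℂ) ^ M))).mono ?_
    rintro _ ⟨x, hx, rfl⟩
    have hRC : (R : ℂ) ≠ 0 := by exact_mod_cast hR.ne'
    refine ⟨_, ⟨x, hx, rfl⟩, _, ⟨_, ⟨(R : ℂ)⁻¹ • x, ?_, rfl⟩, rfl⟩, ?_⟩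
    · rw [mem_closedBall_zero_iff] at hx ⊢
      rw [norm_smul, norm_inv, Complex.norm_real, Real.norm_of_nonneg hR.le, inv_mul_le_iff₀ hR]
      simpa using hx
    · simp only [← taylorPoly_smul, smul_smul, mul_inv_cancel₀ hRC, one_smul]
      rw [Finset.sum_range_succ]

/-- The terms of the Nachbin seminorm of an entire function decay geometrically. -/
theorem exists_eventually_norm_taylorPoly_le [CompleteSpace F] {f : E → F}
    (hf : ∀ x, AnalyticAt ℂ f x) {K : Set E} (hK : IsCompact K) (hKbal : Balanced ℂ K)
    {a : ℕ → ℝ} (ha0 : Tendsto a atTop (nhds 0)) {R : ℝ} (hR : 0 < R) :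
    ∃ C : ℝ, ∀ᶠ m in atTop, ∀ x ∈ K + closedBall (0 : E) (a m),
      ‖taylorPoly f 0 m x‖ ≤ C / R ^ m := by
  have hfc : Continuous f := continuous_iff_continuousAt.2 fun x => (hf x).continuousAt
  have hRK : IsCompact ((R : ℂ) • K) := hK.smul _
  obtain ⟨U, hKU, hU, hfU⟩ :=
    exists_isOpen_isBounded_image_of_isCompact_of_continuousOn (k := (R : ℂ) • K) hRK
      isOpen_univ (Set.subset_univ _) hfc.continuousOn
  obtain ⟨δ, hδ, hδU⟩ := hRK.exists_thickening_subset_open hU hKU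
  obtain ⟨C, hC⟩ := hfU.exists_norm_le
  refine ⟨C, ?_⟩
  filter_upwards [ha0.eventually_lt_const (div_pos hδ hR)] with m hm x hx
  refine norm_taylorPoly_le hf m x hR fun z hz => hC _ ⟨_, hδU ?_, rfl⟩
  obtain ⟨k, hk, b, hb, rfl⟩ := hx
  rw [mem_closedBall_zero_iff] at hb
  have hRC : (R : ℂ) ≠ 0 := by exact_mod_cast hR.ne'
  refine mem_thickening_iff.2 ⟨z • k, ⟨((R : ℂ)⁻¹ * z) • k, ?_, ?_⟩, ?_⟩
  · refine hKbal.smul_mem ?_ hk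
    rw [norm_mul, norm_inv, Complex.norm_real, Real.norm_of_nonneg hR.le, hz,
      inv_mul_cancel₀ hR.ne']
  · simp [smul_smul, mul_inv_cancel_left₀ hRC]
  · rw [dist_eq_norm, smul_add, add_sub_cancel_left, norm_smul, hz]
    calc R * ‖b‖ ≤ R * a m := by gcongr
      _ < R * (δ / R) := by gcongr
      _ = δ := by field_simp

theorem nachbinTerm_nonneg (K : Set E) (a : ℕ → ℝ) (h : E → F) (m : ℕ) :
    0 ≤ nachbinTerm K a h m :=
  Real.sSup_nonneg (by rintro _ ⟨x, -, rfl⟩; exact norm_nonneg _)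

/-- **Lemma 4.8.** Let `E`, `F` be complex Banach spaces and `1 ≤ p < ∞`.  The space
`H_{K_p}(E;F)` of `p`-compact entire functions is `τ_ω`-dense in the space of entire
functions all of whose Taylor polynomials `P_mf(x)`, `x ∈ E`, `m ∈ ℕ`, are `p`-compact:
for every such `f`, every Nachbin seminorm (given by an absolutely convex compact set `K`
and a positive null sequence `(a_m)`) and every `ε > 0` there is a `p`-compact entire `g`
with `q(f - g) ≤ ε`. -/
theorem statement15 [CompleteSpace E] [CompleteSpace F] (p : ℝ) (hp : 1 ≤ p)
    (f : E → F) (hf : ∀ x, AnalyticAt ℂ f x)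
    (hPm : ∀ (x : E) (m : ℕ), IsRelPCompact p (taylorPoly f x m '' closedBall 0 1))
    (K : Set E) (hK : IsCompact K) (hKconv : Convex ℝ K) (hKbal : Balanced ℂ K)
    (a : ℕ → ℝ) (ha : ∀ m, 0 < a m) (ha0 : Filter.Tendsto a Filter.atTop (nhds 0))
    (ε : ℝ) (hε : 0 < ε) :
    ∃ g : E → F,
      (∀ x, AnalyticAt ℂ g x) ∧
      (∀ x : E, PCompactAt p g x) ∧
      (Summable fun m => nachbinTerm K a (fun y => f y - g y) m) ∧
      (∑' m, nachbinTerm K a (fun y => f y - g y) m) ≤ ε := by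
  obtain ⟨C, hC⟩ := exists_eventually_norm_taylorPoly_le hf hK hKbal ha0 (R := 4) (by norm_num)
  have hC2 : ∀ᶠ m : ℕ in atTop, C / 2 ^ m < ε / 2 :=
    (tendsto_const_nhds.div_atTop
      (tendsto_pow_atTop_atTop_of_one_lt (by norm_num : (1 : ℝ) < 2))).eventually_lt_const
      (by positivity)
  obtain ⟨M, hM⟩ := eventually_atTop.1 (hC.and hC2)
  obtain ⟨P, hP⟩ := hf 0
  set Q : FormalMultilinearSeries ℂ E F := fun m => if m < M then P m else 0 with hQ
  have hQ0 : ∀ m, M ≤ m → Q m = 0 := fun m hm => if_neg hm.not_gt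
  have hQs := (Q.hasFiniteFPowerSeriesOnBall_of_finite hQ0).toHasFPowerSeriesOnBall
  have hg : Q.sum = fun x => ∑ m ∈ Finset.range M, taylorPoly f 0 m x := by
    ext x
    rw [Q.sum_of_finite hQ0]
    refine Finset.sum_congr rfl fun m hm => ?_
    rw [taylorPoly_eq_of_hasFPowerSeriesAt hP, hQ]
    simp [Finset.mem_range.1 hm]
  have hfg := hP.sub hQs.hasFPowerSeriesAt
  have hterm : ∀ m, nachbinTerm K a (fun y => f y - Q.sum y) m ≤ ε / 2 / 2 ^ m := by
    intro m
    refine Real.sSup_le ?_ (by positivity)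
    rintro _ ⟨x, hx, rfl⟩
    have hT : taylorPoly (fun y => f y - Q.sum y) 0 m x = P m (fun _ => x) - Q m fun _ => x :=
      taylorPoly_eq_of_hasFPowerSeriesAt hfg m x
    rw [hT]
    by_cases hm : m < M
    · simp only [hQ, hm, if_true, sub_self, norm_zero]
      positivity
    · rw [hQ0 m (not_lt.1 hm), zero_apply, sub_zero,
        ← taylorPoly_eq_of_hasFPowerSeriesAt hP]
      obtain ⟨h1, h2⟩ := hM m (not_lt.1 hm)
      calc ‖taylorPoly f 0 m x‖ ≤ C / 4 ^ m := h1 x hx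
        _ = C / 2 ^ m / 2 ^ m := by
          rw [div_div, ← mul_pow]; norm_num
        _ ≤ ε / 2 / 2 ^ m := by gcongr
  have hgeo := hasSum_geometric_two' ε
  have hsum := Summable.of_nonneg_of_le (fun m => nachbinTerm_nonneg K a _ m) hterm hgeo.summable
  refine ⟨Q.sum, fun x => hQs.analyticAt_of_mem (by simp), fun x => ?_, hsum, ?_⟩
  · refine ⟨closedBall 0 (‖x‖ + 1), closedBall_mem_nhds_of_mem (by simp), ?_⟩
    rw [hg]
    exact isRelPCompact_image_sum_taylorPoly hp (hPm 0) (by positivity) M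
  · exact (hsum.tsum_le_tsum hterm hgeo.summable).trans_eq hgeo.tsum_eq

end
end
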